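/- For the Sierpinski gasket graph SG(n), the number HC(n) of Hamiltonian cycles satisfies HC(1) = 1 and, for every integer n ≥ 2, HC(n) = 2^(3^(n-1)) · 3^((3^(n-1)-3)/2) (equivalently, HC(n) = √3·(2√3)^(3^(n-1))/9). -/

import Mathlib

open scoped Classical
open Filter Topology

noncomputable section

namespace SierpinskiGasket

/-- √3 -/
def sq3 : ℝ := Real.sqrt 3

/-- the origin, leftmost outmost vertex of every `SG n` -/
def o : ℝ × ℝ := (0, 0)

/-- `a m = (2^m, 0)`, the rightmost vertex of `SG m` (also a translation vector). -/
def a (m : ℕ) : ℝ × ℝ := ((2:ℝ) ^ m, 0)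

/-- `b m = (2^(m-1), 2^(m-1)·√3)`, the topmost vertex of `SG m`. -/
def b (m : ℕ) : ℝ × ℝ := ((2:ℝ) ^ m / 2, (2:ℝ) ^ m / 2 * sq3)

/-- `c m = (3·2^(m-1), 2^(m-1)·√3)`. -/
def c (m : ℕ) : ℝ × ℝ := (3 * (2:ℝ) ^ m / 2, (2:ℝ) ^ m / 2 * sq3)

/-- vertex set of `SG n` -/
def V : ℕ → Set (ℝ × ℝ)
  | 0 => {o, a 0, b 0}
  | n + 1 => V n ∪ ((· + a n) '' V n) ∪ ((· + b n) '' V n)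

/-- edge set of `SG n` -/
def E : ℕ → Set (Sym2 (ℝ × ℝ))
  | 0 => {s(o, a 0), s(o, b 0), s(a 0, b 0)}
  | n + 1 => E n ∪ (Sym2.map (· + a n) '' E n) ∪ (Sym2.map (· + b n) '' E n)

/-- `SG n` as a simple graph on `ℝ × ℝ` -/
def G (n : ℕ) : SimpleGraph (ℝ × ℝ) := SimpleGraph.fromEdgeSet (E n)

/-- a Hamiltonian path of `SG n`: a path visiting every vertex of `SG n` exactly once -/
def IsHamPath (n : ℕ) {u v : ℝ × ℝ} (p : (G n).Walk u v) : Prop :=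
  p.IsPath ∧ ∀ x, x ∈ p.support ↔ x ∈ V n

/-- a Hamiltonian cycle of `SG n` -/
def IsHamCycle (n : ℕ) {u : ℝ × ℝ} (p : (G n).Walk u u) : Prop :=
  p.IsCycle ∧ ∀ x, x ∈ p.support ↔ x ∈ V n

/-- `f n u v`: the number of Hamiltonian paths of `SG n` with end-vertex set `{u, v}`
(for `u ≠ v`, such unordered paths correspond bijectively to walks from `u` to `v`). -/
def f (n : ℕ) (u v : ℝ × ℝ) : ℕ := Nat.card {p : (G n).Walk u v // IsHamPath n p}

/-- `f1 n`: the number of Hamiltonian paths of `SG n` with end-vertex set `{o, a n}` -/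
def f1 (n : ℕ) : ℕ := f n o (a n)

/-- the number of Hamiltonian cycles of `SG n`, counted up to starting vertex and
orientation: every Hamiltonian cycle passes through `o` and has exactly two
representatives as a closed walk based at `o`. -/
def HC (n : ℕ) : ℕ := Nat.card {p : (G n).Walk o o // IsHamCycle n p} / 2

/-- the number of Hamiltonian paths of `SG n` having `o` as one of their end vertices -/
def H0 (n : ℕ) : ℕ := ∑ᶠ x ∈ {x : ℝ × ℝ | x ≠ o}, f n o x

/-- the total number of Hamiltonian paths of `SG n` (a path and its reversal
are the same unordered object, whence the division by `2`). -/
def H (n : ℕ) : ℕ := (∑ᶠ u : ℝ × ℝ, ∑ᶠ v : ℝ × ℝ, f n u v) / 2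

/-- the distribution ratio `F(n,x) = f(n,x)/f1(n)` -/
def F (n : ℕ) (x : ℝ × ℝ) : ℝ := (f n o x : ℝ) / (f1 n : ℝ)

/-- `SG n` with the vertex `b n` (and its incident edges) deleted -/
def Gd (n : ℕ) : SimpleGraph (ℝ × ℝ) := SimpleGraph.fromEdgeSet {e ∈ E n | b n ∉ e}

/-- Hamiltonian path of `SG n - b n` -/
def IsHamPathD (n : ℕ) {u v : ℝ × ℝ} (p : (Gd n).Walk u v) : Prop :=
  p.IsPath ∧ ∀ x, x ∈ p.support ↔ (x ∈ V n ∧ x ≠ b n)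

/-- `g2 n x`: the number of Hamiltonian paths of `SG n - b n` with end-vertex set `{o, x}` -/
def g2 (n : ℕ) (x : ℝ × ℝ) : ℕ := Nat.card {p : (Gd n).Walk o x // IsHamPathD n p}

/-- `g1 n`: the number of Hamiltonian paths of `SG n - b n` with end-vertex set `{o, a n}` -/
def g1 (n : ℕ) : ℕ := g2 n (a n)

/-- the distribution ratio `G₂(n,x) = g₂(n,x)/g₁(n)` -/
def G2 (n : ℕ) (x : ℝ × ℝ) : ℝ := (g2 n x : ℝ) / (g1 n : ℝ)

/-- mid-side vertex `a_{m,1} = (3·2^(m-1), 0)` -/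
def a1 (m : ℕ) : ℝ × ℝ := (3 * (2:ℝ) ^ m / 2, 0)

/-- mid-side vertex `b_{m,1} = (5·2^(m-2), 2^(m-2)·√3)` -/
def b1 (m : ℕ) : ℝ × ℝ := (5 * (2:ℝ) ^ m / 4, (2:ℝ) ^ m / 4 * sq3)

/-- mid-side vertex `c_{m,1} = (7·2^(m-2), 2^(m-2)·√3)` -/
def c1 (m : ℕ) : ℝ × ℝ := (7 * (2:ℝ) ^ m / 4, (2:ℝ) ^ m / 4 * sq3)

/-- mid-side vertex `a_{m,2} = (2^m, 2^(m-1)·√3)` -/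
def a2 (m : ℕ) : ℝ × ℝ := ((2:ℝ) ^ m, (2:ℝ) ^ m / 2 * sq3)

/-- mid-side vertex `b_{m,2} = (3·2^(m-2), 3·2^(m-2)·√3)` -/
def b2 (m : ℕ) : ℝ × ℝ := (3 * (2:ℝ) ^ m / 4, 3 * (2:ℝ) ^ m / 4 * sq3)

/-- mid-side vertex `c_{m,2} = (5·2^(m-2), 3·2^(m-2)·√3)` -/
def c2 (m : ℕ) : ℝ × ℝ := (5 * (2:ℝ) ^ m / 4, 3 * (2:ℝ) ^ m / 4 * sq3)

/-- exceptional vertex `a* = (2^(n-1), (2^(n-1)-1)·√3)` -/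
def astar (n : ℕ) : ℝ × ℝ := ((2:ℝ) ^ n / 2, ((2:ℝ) ^ n / 2 - 1) * sq3)

/-- exceptional vertex `b* = (2^(n-1) - 1/2, (2^n-1)·√3/2)` -/
def bstar (n : ℕ) : ℝ × ℝ := ((2:ℝ) ^ n / 2 - 1/2, ((2:ℝ) ^ n - 1) * sq3 / 2)

/-- exceptional vertex `c* = (2^(n-1) + 1/2, (2^n-1)·√3/2)` -/
def cstar (n : ℕ) : ℝ × ℝ := ((2:ℝ) ^ n / 2 + 1/2, ((2:ℝ) ^ n - 1) * sq3 / 2)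

/-- the Euclidean norm on `ℝ × ℝ` -/
def enorm (x : ℝ × ℝ) : ℝ := Real.sqrt (x.1 ^ 2 + x.2 ^ 2)

/-- the set `C n` of corner vertices of `SG n` -/
def C (n : ℕ) : Finset (ℝ × ℝ) :=
  ((Finset.range (n + 1)).image a) ∪ ((Finset.range (n + 1)).image b) ∪
    ((Finset.range n).image c)

/-- the mean `ℓ` displacement over the corner vertices -/
def xi' (n : ℕ) (ℓ : ℝ) : ℝ :=
  (∑ x ∈ C n, enorm x ^ ℓ * F n x) / (∑ x ∈ C n, F n x)

/-- `p(n,x)`: the probability that a Hamiltonian path with one end at `o`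
has its other end at `x` -/
def p (n : ℕ) (x : ℝ × ℝ) : ℝ := (f n o x : ℝ) / (H0 n : ℝ)

/-- the mean `ℓ` displacement of Hamiltonian paths on `SG n` with one end at `o` -/
def xi (n : ℕ) (ℓ : ℝ) : ℝ :=
  ∑ᶠ x ∈ {x : ℝ × ℝ | x ∈ V n ∧ x ≠ o}, enorm x ^ ℓ * p n x

/-- the partition function of Hamiltonian paths on `SG n` -/
def Z (n : ℕ) (β : ℝ) : ℝ := (H n : ℝ) * Real.exp (-(β * ((3 ^ (n + 1) + 1) / 2)))

section Lists

variable {α β : Type*}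

/-- Hamiltonian paths from `u` to `v` in the relation `R` restricted to `S`, each recorded as the
list of its interior vertices. -/
def pathLists (R : α → α → Prop) (S : Set α) (u v : α) : Set (List α) :=
  {m | (u :: m ++ [v]).Nodup ∧ (u :: m ++ [v]).IsChain R ∧ ∀ x, x ∈ u :: m ++ [v] ↔ x ∈ S}

/-- Hamiltonian closed walks based at `u` in the relation `R` restricted to `S`, each recorded as
the list of the vertices other than `u`. -/
def cycleLists (R : α → α → Prop) (S : Set α) (u : α) : Set (List α) :=
  {m | (u :: m).Nodup ∧ (u :: m ++ [u]).IsChain R ∧ ∀ x, x ∈ u :: m ↔ x ∈ S}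

/-- All concatenations of a list in `X` and a list in `Y` with `q` inserted in between. -/
def joinAt (q : α) (X Y : Set (List α)) : Set (List α) :=
  Set.image2 (fun s t => s ++ q :: t) X Y

variable {R : α → α → Prop} {S T A B C : Set α} {p q r u v w : α}

theorem length_eq_of_mem_pathLists {m m' : List α} (h : m ∈ pathLists R S u v)
    (h' : m' ∈ pathLists R S u v) : m.length = m'.length := by
  have := ((List.perm_ext_iff_of_nodup h.1 h'.1).2 fun x =>
    (h.2.2 x).trans (h'.2.2 x).symm).length_eq
  simpa using this

theorem encard_joinAt {X Y : Set (List α)} (h : ∀ s ∈ X, ∀ s' ∈ X, s.length = s'.length) :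
    (joinAt q X Y).encard = X.encard * Y.encard := by
  rw [joinAt, ← Set.image_prod, Set.InjOn.encard_image, Set.encard_prod]
  rintro ⟨s, t⟩ hs ⟨s', t'⟩ hs' heq
  have := List.append_inj heq (h _ hs.1 _ hs'.1)
  simp_all

theorem encard_joinAt_pathLists {Y : Set (List α)} :
    (joinAt q (pathLists R S u v) Y).encard = (pathLists R S u v).encard * Y.encard :=
  encard_joinAt fun _ h _ h' => length_eq_of_mem_pathLists h h'

theorem append_mem_pathLists {s t : List α} (hs : s ∈ pathLists R S u q)
    (ht : t ∈ pathLists R T q v) (h : ∀ x ∈ S, x ∈ T → x = q) :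
    s ++ q :: t ∈ pathLists R (S ∪ T) u v := by
  obtain ⟨hs1, hs2, hs3⟩ := hs
  obtain ⟨ht1, ht2, ht3⟩ := ht
  refine ⟨?_, ?_, ?_⟩
  · have e : u :: (s ++ q :: t) ++ [v] = (u :: s ++ [q]) ++ (t ++ [v]) := by simp
    rw [e, List.nodup_append]
    refine ⟨hs1, by grind, ?_⟩
    grind
  · have e : u :: (s ++ q :: t) ++ [v] = (u :: s) ++ q :: (t ++ [v]) := by simp
    rw [e, List.isChain_split]
    exact ⟨hs2, ht2⟩
  · grind

theorem ends_mem_of_mem_pathLists {m : List α} (h : m ∈ pathLists R S u v) : u ∈ S ∧ v ∈ S :=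
  ⟨(h.2.2 u).1 (by simp), (h.2.2 v).1 (by simp)⟩

theorem mem_of_mem_pathLists {m : List α} {x : α} (h : m ∈ pathLists R S u v) (hx : x ∈ S)
    (hu : x ≠ u) (hv : x ≠ v) : x ∈ m := by
  simpa [hu, hv] using (h.2.2 x).2 hx

theorem nodup_of_mem_pathLists {m : List α} (h : m ∈ pathLists R S u v) : m.Nodup :=
  h.1.sublist ((List.sublist_cons_self u m).trans (List.sublist_append_left _ _))

theorem exists_mem_pathLists_of_append {s t : List α} (h : s ++ q :: t ∈ pathLists R S u v) :
    ∃ S₁ S₂ : Set α, s ∈ pathLists R S₁ u q ∧ t ∈ pathLists R S₂ q v ∧ S₁ ∪ S₂ = S ∧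
      ∀ x ∈ S₁, x ∈ S₂ → x = q := by
  obtain ⟨h1, h2, h3⟩ := h
  have e : u :: (s ++ q :: t) ++ [v] = (u :: s) ++ q :: (t ++ [v]) := by simp
  rw [e] at h1 h2
  rw [List.isChain_split] at h2
  have hn := List.nodup_append.1 h1
  refine ⟨{x | x ∈ u :: s ++ [q]}, {x | x ∈ q :: t ++ [v]}, ⟨?_, h2.1, fun _ => Iff.rfl⟩,
    ⟨hn.2.1, h2.2, fun _ => Iff.rfl⟩, ?_, ?_⟩
  · exact h1.sublist (by simp)
  · ext x
    rw [← h3]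
    simp only [Set.mem_union, Set.mem_ofPred_eq, List.mem_append, List.mem_cons]
    tauto
  · intro x hx hx'
    by_contra hne
    refine hn.2.2 x ?_ x hx' rfl
    simpa [hne] using hx

theorem idxOf_lt_of_append {s t : List α} {x y : α} (h : (s ++ x :: t).Nodup) (hy : y ∈ t) :
    (s ++ x :: t).idxOf x < (s ++ x :: t).idxOf y := by
  have hx : x ∉ s := by grind
  have hy' : y ∉ s := by grind
  have hxy : x ≠ y := by grind
  rw [List.idxOf_append_of_notMem hx, List.idxOf_append_of_notMem hy']
  simp [List.idxOf_cons_ne _ hxy]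

theorem exists_append_of_idxOf_lt {m : List α} {x y : α} (hy : y ∈ m)
    (hxy : m.idxOf x < m.idxOf y) : ∃ s₀ s₁ s₂, m = s₀ ++ x :: (s₁ ++ y :: s₂) := by
  have hx : x ∈ m := List.idxOf_lt_length_iff.1 (by have := List.idxOf_lt_length_iff.2 hy; omega)
  obtain ⟨s₀, t, rfl, hx0⟩ := List.eq_append_cons_of_mem hx
  have hy0 : y ∉ s₀ := by
    intro h
    rw [List.idxOf_append_of_notMem hx0, List.idxOf_append_of_mem h] at hxy
    have := List.idxOf_lt_length_iff.2 h
    omega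
  have hyx : x ≠ y := by rintro rfl; omega
  obtain ⟨s₁, s₂, rfl⟩ := List.append_of_mem (a := y) (l := t) (by grind)
  exact ⟨s₀, s₁, s₂, rfl⟩

theorem exists_append_of_idxOf_lt_of_lt {m : List α} {x y z : α} (hn : m.Nodup) (hz : z ∈ m)
    (hxy : m.idxOf x < m.idxOf y) (hyz : m.idxOf y < m.idxOf z) :
    ∃ s₀ s₁ s₂ s₃, m = s₀ ++ x :: (s₁ ++ y :: (s₂ ++ z :: s₃)) := by
  obtain ⟨t, s₂, s₃, rfl⟩ := exists_append_of_idxOf_lt hz hyz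
  have hy : y ∉ t := by grind
  have hx : x ∈ t := by
    by_contra hx
    rw [List.idxOf_append_of_notMem hx, List.idxOf_append_of_notMem hy, List.idxOf_cons_self] at hxy
    omega
  obtain ⟨s₀, s₁, rfl⟩ := List.append_of_mem hx
  exact ⟨s₀, s₁, s₂, s₃, by simp⟩

theorem encard_pathLists_image {R' : β → β → Prop} {φ : α → β} (hφ : φ.Injective)
    (hR : ∀ x ∈ S, ∀ y ∈ S, R' (φ x) (φ y) ↔ R x y) :
    (pathLists R' (φ '' S) (φ u) (φ v)).encard = (pathLists R S u v).encard := by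
  rw [← ((List.map_injective_iff.2 hφ).injOn (s := pathLists R S u v)).encard_image]
  have e : ∀ m : List α, φ u :: m.map φ ++ [φ v] = (u :: m ++ [v]).map φ := by simp
  congr 1
  ext m
  constructor
  · rintro ⟨h1, h2, h3⟩
    have hm : ∀ x ∈ m, x ∈ φ '' S := fun x hx => (h3 x).1 (by simp [hx])
    obtain ⟨m, rfl⟩ : ∃ m' : List α, m = m'.map φ := by
      have : m ∈ Set.range (List.map φ) := by
        rw [Set.range_list_map]
        intro x hx
        obtain ⟨y, -, rfl⟩ := hm x hx
        exact ⟨y, rfl⟩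
      obtain ⟨m', rfl⟩ := this
      exact ⟨m', rfl⟩
    rw [e] at h1 h2
    have h3' : ∀ x, x ∈ u :: m ++ [v] ↔ x ∈ S := fun x => by
      rw [← hφ.mem_set_image (s := S), ← h3, e, List.mem_map_of_injective hφ]
    refine ⟨m, ⟨h1.of_map, ?_, h3'⟩, rfl⟩
    rw [List.isChain_map] at h2
    exact h2.imp_of_mem_imp fun x y hx hy h => (hR x ((h3' x).1 hx) y ((h3' y).1 hy)).1 h
  · rintro ⟨m, ⟨h1, h2, h3⟩, rfl⟩
    refine ⟨?_, ?_, ?_⟩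
    · rw [e]; exact h1.map hφ
    · rw [e, List.isChain_map]
      exact h2.imp_of_mem_imp fun x y hx hy h => (hR x ((h3 x).1 hx) y ((h3 y).1 hy)).2 h
    · intro x
      rw [e, List.mem_map]
      simp only [h3]
      rfl

/-- `A ∪ B ∪ C` is the union of three pieces meeting pairwise in the single points `p`, `q`, `r`,
and every `R`-edge inside the union lies in one of the pieces. -/
structure IsGluing (R : α → α → Prop) (A B C : Set α) (p q r : α) : Prop where
  inter_AB : ∀ x, x ∈ A ∧ x ∈ B ↔ x = p
  inter_AC : ∀ x, x ∈ A ∧ x ∈ C ↔ x = q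
  inter_BC : ∀ x, x ∈ B ∧ x ∈ C ↔ x = r
  notMem : p ∉ C
  edge : ∀ x ∈ A ∪ B ∪ C, ∀ y ∈ A ∪ B ∪ C, R x y → x ∈ A ∧ y ∈ A ∨ x ∈ B ∧ y ∈ B ∨ x ∈ C ∧ y ∈ C

namespace IsGluing

theorem segment (h : IsGluing R A B C p q r) {x y : α} {s : List α}
    (hc : (x :: s ++ [y]).IsChain R) (hS : ∀ z ∈ x :: s ++ [y], z ∈ A ∪ B ∪ C)
    (hp : p ∉ s) (hq : q ∉ s) (hr : r ∉ s) :
    (∀ z ∈ x :: s ++ [y], z ∈ A) ∨ (∀ z ∈ x :: s ++ [y], z ∈ B) ∨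
      (∀ z ∈ x :: s ++ [y], z ∈ C) := by
  induction s generalizing x with
  | nil =>
    have := h.edge x (hS x (by simp)) y (hS y (by simp)) (by simpa using hc)
    simpa using this
  | cons z s ih =>
    have hc' : R x z ∧ (z :: s ++ [y]).IsChain R := by simpa using hc
    have h1 := h.edge x (hS x (by simp)) z (hS z (by simp)) hc'.1
    have h2 := ih hc'.2 (fun w hw => hS w (List.mem_cons_of_mem x hw)) (by grind) (by grind)
      (by grind)
    have hAB := (h.inter_AB z).1
    have hAC := (h.inter_AC z).1
    have hBC := (h.inter_BC z).1
    simp only [List.cons_append, List.forall_mem_cons] at h2 ⊢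
    grind

theorem swap (h : IsGluing R A B C p q r) : IsGluing R C B A r q p where
  inter_AB x := by rw [← h.inter_BC, and_comm]
  inter_AC x := by rw [← h.inter_AC, and_comm]
  inter_BC x := by rw [← h.inter_AB, and_comm]
  notMem hr := by
    have := h.notMem
    have := h.inter_AB r
    have := h.inter_BC r
    grind
  edge x hx y hy hxy := by
    have := h.edge x (by grind) y (by grind) hxy
    tauto

theorem junctions (h : IsGluing R A B C p q r) :
    (p ∈ A ∧ p ∈ B ∧ p ∉ C) ∧ (q ∈ A ∧ q ∉ B ∧ q ∈ C) ∧ (r ∉ A ∧ r ∈ B ∧ r ∈ C) ∧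
      p ≠ q ∧ p ≠ r ∧ q ≠ r := by
  have := h.notMem
  have := h.inter_AB
  have := h.inter_AC
  have := h.inter_BC
  grind

theorem subset_of_mem_pathLists (h : IsGluing R A B C p q r) {m : List α}
    (hm : m ∈ pathLists R S u v)
    (hS : S ⊆ A ∪ B ∪ C) (hp : p ∈ S → p = u ∨ p = v) (hq : q ∈ S → q = u ∨ q = v)
    (hr : r ∈ S → r = u ∨ r = v) : S ⊆ A ∨ S ⊆ B ∨ S ⊆ C := by
  obtain ⟨h1, h2, h3⟩ := hm
  have hn : ∀ x ∈ m, x ∈ S ∧ x ≠ u ∧ x ≠ v := fun x hx =>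
    ⟨(h3 x).1 (by simp [hx]), by grind, by grind⟩
  have := h.segment h2 (fun z hz => hS ((h3 z).1 hz)) (fun hm => by grind) (fun hm => by grind)
    (fun hm => by grind)
  simp only [h3] at this
  exact this

/-- A Hamiltonian path of the union splits into four segments at its junctions, each of them
contained in a single piece. -/
theorem exists_segments (h : IsGluing R A B C p q r) {s₀ s₁ s₂ s₃ : List α} {x y z : α}
    (hm : s₀ ++ x :: (s₁ ++ y :: (s₂ ++ z :: s₃)) ∈ pathLists R (A ∪ B ∪ C) u v)
    (hp : p = x ∨ p = y ∨ p = z) (hq : q = x ∨ q = y ∨ q = z) (hr : r = x ∨ r = y ∨ r = z) :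
    ∃ S₀ S₁ S₂ S₃ : Set α,
      (s₀ ∈ pathLists R S₀ u x ∧ s₁ ∈ pathLists R S₁ x y ∧
        s₂ ∈ pathLists R S₂ y z ∧ s₃ ∈ pathLists R S₃ z v) ∧
      (∀ c, (c ∈ S₀ ∨ c ∈ S₁ ∨ c ∈ S₂ ∨ c ∈ S₃) ↔ c ∈ A ∨ c ∈ B ∨ c ∈ C) ∧
      (∀ c ∈ S₀, (c ∈ S₁ ∨ c ∈ S₂ ∨ c ∈ S₃) → c = x) ∧ (∀ c ∈ S₁, (c ∈ S₂ ∨ c ∈ S₃) → c = y) ∧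
      (∀ c ∈ S₂, c ∈ S₃ → c = z) ∧
      (u ∈ S₀ ∧ x ∈ S₀ ∧ x ∈ S₁ ∧ y ∈ S₁ ∧ y ∈ S₂ ∧ z ∈ S₂ ∧ z ∈ S₃ ∧ v ∈ S₃) ∧
      (S₀ ⊆ A ∨ S₀ ⊆ B ∨ S₀ ⊆ C) ∧ (S₁ ⊆ A ∨ S₁ ⊆ B ∨ S₁ ⊆ C) ∧
      (S₂ ⊆ A ∨ S₂ ⊆ B ∨ S₂ ⊆ C) ∧ (S₃ ⊆ A ∨ S₃ ⊆ B ∨ S₃ ⊆ C) := by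
  obtain ⟨S₀, T₀, h0, hm₀, e0, d0⟩ := exists_mem_pathLists_of_append hm
  obtain ⟨S₁, T₁, h1, hm₁, e1, d1⟩ := exists_mem_pathLists_of_append hm₀
  obtain ⟨S₂, S₃, h2, h3, e2, d2⟩ := exists_mem_pathLists_of_append hm₁
  clear hm hm₀ hm₁
  subst e2
  subst e1
  have m0 := ends_mem_of_mem_pathLists h0
  have m1 := ends_mem_of_mem_pathLists h1
  have m2 := ends_mem_of_mem_pathLists h2
  have m3 := ends_mem_of_mem_pathLists h3
  refine ⟨S₀, S₁, S₂, S₃, ⟨h0, h1, h2, h3⟩, ?_, d0, d1, d2, by tauto, ?_, ?_, ?_, ?_⟩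
  · intro c
    have := congrArg (c ∈ ·) e0
    grind
  · exact h.subset_of_mem_pathLists h0 (by grind) (by grind) (by grind) (by grind)
  · exact h.subset_of_mem_pathLists h1 (by grind) (by grind) (by grind) (by grind)
  · exact h.subset_of_mem_pathLists h2 (by grind) (by grind) (by grind) (by grind)
  · exact h.subset_of_mem_pathLists h3 (by grind) (by grind) (by grind) (by grind)

theorem setOf_pathLists_qrp (h : IsGluing R A B C p q r) (huB : u ∉ B)
    (huC : u ∉ C) (hvA : v ∉ A) (hvC : v ∉ C) :
    {m ∈ pathLists R (A ∪ B ∪ C) u v | m.idxOf q < m.idxOf r ∧ m.idxOf r < m.idxOf p} =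
      joinAt q (pathLists R (A \ {p}) u q) (joinAt r (pathLists R C q r) (pathLists R B r v)) := by
  have hj := h.junctions
  have hAB := h.inter_AB
  have hAC := h.inter_AC
  have hBC := h.inter_BC
  ext m
  constructor
  · rintro ⟨hm, hi1, hi2⟩
    obtain ⟨s₀, s₁, s₂, s₃, rfl⟩ := exists_append_of_idxOf_lt_of_lt (nodup_of_mem_pathLists hm)
      (mem_of_mem_pathLists hm (by grind) (by grind) (by grind)) hi1 hi2
    obtain ⟨S₀, S₁, S₂, S₃, ⟨h0, h1, h2, h3⟩, e, d0, d1, d2, hmem, g0, g1, g2, g3⟩ :=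
      h.exists_segments hm (by simp) (by simp) (by simp)
    clear hm hi1 hi2
    replace g0 : S₀ ⊆ A := by grind
    replace g1 : S₁ ⊆ C := by grind
    replace g2 : S₂ ⊆ B := by grind
    replace g3 : S₃ ⊆ B := by grind
    have e0 : S₀ = A \ {p} := by ext c; grind
    have e1 : S₁ = C := by ext c; grind
    have e2 : S₂ ∪ S₃ = B := by ext c; grind
    exact ⟨s₀, e0 ▸ h0, _, ⟨s₁, e1 ▸ h1, s₂ ++ p :: s₃,
      e2 ▸ append_mem_pathLists h2 h3 d2, rfl⟩, rfl⟩
  · rintro ⟨s, hs, -, ⟨s', hs', t, ht, rfl⟩, rfl⟩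
    have hm := append_mem_pathLists hs (append_mem_pathLists hs' ht (by grind)) (by grind)
    have e : A \ {p} ∪ (C ∪ B) = A ∪ B ∪ C := by ext; grind
    rw [e] at hm
    have hp : p ∈ t := mem_of_mem_pathLists ht (by grind) (by grind) (by grind)
    have hn : (s ++ q :: (s' ++ r :: t)).Nodup := nodup_of_mem_pathLists hm
    refine ⟨hm, idxOf_lt_of_append hn (by simp), ?_⟩
    have := idxOf_lt_of_append (s := s ++ q :: s') (by simpa using hn) hp
    simpa using this

theorem setOf_pathLists_qpr (h : IsGluing R A B C p q r) (huA : u ∈ A) (huC : u ∉ C) (hvA : v ∉ A)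
    (hvC : v ∉ C) :
    {m ∈ pathLists R (A ∪ B ∪ C) u v | m.idxOf q < m.idxOf p ∧ m.idxOf p < m.idxOf r} =
      if C ⊆ {q, r} then joinAt p (pathLists R A u p) (pathLists R B p v) else ∅ := by
  have hj := h.junctions
  have hAB := h.inter_AB
  have hAC := h.inter_AC
  have hBC := h.inter_BC
  have key : ∀ m ∈ pathLists R (A ∪ B ∪ C) u v, m.idxOf q < m.idxOf p → m.idxOf p < m.idxOf r →
      C ⊆ {q, r} ∧ m ∈ joinAt p (pathLists R A u p) (pathLists R B p v) := by
    intro m hm hi1 hi2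
    obtain ⟨s₀, s₁, s₂, s₃, rfl⟩ := exists_append_of_idxOf_lt_of_lt (nodup_of_mem_pathLists hm)
      (mem_of_mem_pathLists hm (by grind) (by grind) (by grind)) hi1 hi2
    obtain ⟨S₀, S₁, S₂, S₃, ⟨h0, h1, h2, h3⟩, e, d0, d1, d2, hmem, g0, g1, g2, g3⟩ :=
      h.exists_segments hm (by simp) (by simp) (by simp)
    clear hm hi1 hi2
    replace g0 : S₀ ⊆ A := by grind
    replace g1 : S₁ ⊆ A := by grind
    replace g2 : S₂ ⊆ B := by grind
    replace g3 : S₃ ⊆ B := by grind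
    have e0 : S₀ ∪ S₁ = A := by ext c; grind
    have e2 : S₂ ∪ S₃ = B := by ext c; grind
    refine ⟨fun c hc => by grind, s₀ ++ q :: s₁, e0 ▸ append_mem_pathLists h0 h1 (by grind),
      s₂ ++ r :: s₃, e2 ▸ append_mem_pathLists h2 h3 d2, by simp⟩
  ext m
  split_ifs with hC
  · refine ⟨fun hm => (key m hm.1 hm.2.1 hm.2.2).2, ?_⟩
    rintro ⟨s, hs, t, ht, rfl⟩
    have hm := append_mem_pathLists hs ht (by grind)
    have e : A ∪ B = A ∪ B ∪ C := by ext; grind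
    rw [e] at hm
    have hq : q ∈ s := mem_of_mem_pathLists hs (by grind) (by grind) (by grind)
    have hr : r ∈ t := mem_of_mem_pathLists ht (by grind) (by grind) (by grind)
    have hn : (s ++ p :: t).Nodup := nodup_of_mem_pathLists hm
    refine ⟨hm, ?_, idxOf_lt_of_append hn hr⟩
    obtain ⟨s, s', rfl⟩ := List.append_of_mem hq
    simpa using idxOf_lt_of_append (s := s) (x := q) (t := s' ++ p :: t) (y := p)
      (by simpa using hn) (by simp)
  · exact ⟨fun hm => hC (key m hm.1 hm.2.1 hm.2.2).1, fun hm => hm.elim⟩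

theorem setOf_pathLists_pqr (h : IsGluing R A B C p q r) (huA : u ∈ A) (huB : u ∉ B)
    (hvA : v ∉ A) (hvC : v ∉ C) :
    {m ∈ pathLists R (A ∪ B ∪ C) u v | m.idxOf p < m.idxOf q ∧ m.idxOf q < m.idxOf r} =
      joinAt q (pathLists R A u q) (joinAt r (pathLists R C q r) (pathLists R (B \ {p}) r v)) := by
  have hj := h.junctions
  have hAB := h.inter_AB
  have hAC := h.inter_AC
  have hBC := h.inter_BC
  ext m
  constructor
  · rintro ⟨hm, hi1, hi2⟩
    obtain ⟨s₀, s₁, s₂, s₃, rfl⟩ := exists_append_of_idxOf_lt_of_lt (nodup_of_mem_pathLists hm)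
      (mem_of_mem_pathLists hm (by grind) (by grind) (by grind)) hi1 hi2
    obtain ⟨S₀, S₁, S₂, S₃, ⟨h0, h1, h2, h3⟩, e, d0, d1, d2, hmem, g0, g1, g2, g3⟩ :=
      h.exists_segments hm (by simp) (by simp) (by simp)
    clear hm hi1 hi2
    replace g0 : S₀ ⊆ A := by grind
    replace g1 : S₁ ⊆ A := by grind
    replace g2 : S₂ ⊆ C := by grind
    replace g3 : S₃ ⊆ B := by grind
    have e0 : S₀ ∪ S₁ = A := by ext c; grind
    have e1 : S₂ = C := by ext c; grind
    have e2 : S₃ = B \ {p} := by ext c; grind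
    exact ⟨s₀ ++ p :: s₁, e0 ▸ append_mem_pathLists h0 h1 (by grind), _,
      ⟨s₂, e1 ▸ h2, s₃, e2 ▸ h3, rfl⟩, by simp⟩
  · rintro ⟨s, hs, -, ⟨s', hs', t, ht, rfl⟩, rfl⟩
    have hm := append_mem_pathLists hs (append_mem_pathLists hs' ht (by grind)) (by grind)
    have e : A ∪ (C ∪ B \ {p}) = A ∪ B ∪ C := by ext; grind
    rw [e] at hm
    have hp : p ∈ s := mem_of_mem_pathLists hs (by grind) (by grind) (by grind)
    have hn : (s ++ q :: (s' ++ r :: t)).Nodup := nodup_of_mem_pathLists hm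
    refine ⟨hm, ?_, idxOf_lt_of_append hn (by simp)⟩
    obtain ⟨s, s'', rfl⟩ := List.append_of_mem hp
    simpa using idxOf_lt_of_append (s := s) (x := p) (t := s'' ++ q :: (s' ++ r :: t)) (y := q)
      (by simpa using hn) (by simp)

theorem encard_pathLists (h : IsGluing R A B C p q r) (huA : u ∈ A) (huB : u ∉ B)
    (huC : u ∉ C) (hvA : v ∉ A) (hvC : v ∉ C) :
    (pathLists R (A ∪ B ∪ C) u v).encard =
      (pathLists R (A \ {p}) u q).encard * ((pathLists R C q r).encard * (pathLists R B r v).encard)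
      + (pathLists R A u q).encard *
        ((pathLists R C q r).encard * (pathLists R (B \ {p}) r v).encard)
      + if C ⊆ {q, r} then (pathLists R A u p).encard * (pathLists R B p v).encard else 0 := by
  have hj := h.junctions
  have hAB := h.inter_AB
  have hAC := h.inter_AC
  have hBC := h.inter_BC
  have hu : pathLists R (A ∪ B ∪ C) u v =
      {m ∈ pathLists R (A ∪ B ∪ C) u v | m.idxOf q < m.idxOf r ∧ m.idxOf r < m.idxOf p} ∪
      {m ∈ pathLists R (A ∪ B ∪ C) u v | m.idxOf p < m.idxOf q ∧ m.idxOf q < m.idxOf r} ∪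
      {m ∈ pathLists R (A ∪ B ∪ C) u v | m.idxOf q < m.idxOf p ∧ m.idxOf p < m.idxOf r} := by
    ext m
    refine ⟨fun hm => ?_, by grind⟩
    have hp : p ∈ m := mem_of_mem_pathLists hm (by grind) (by grind) (by grind)
    have hq : q ∈ m := mem_of_mem_pathLists hm (by grind) (by grind) (by grind)
    have hr : r ∈ m := mem_of_mem_pathLists hm (by grind) (by grind) (by grind)
    have hpq : m.idxOf p ≠ m.idxOf q := fun e => hj.2.2.2.1 ((List.idxOf_inj hp).1 e)
    have hpr : m.idxOf p ≠ m.idxOf r := fun e => hj.2.2.2.2.1 ((List.idxOf_inj hp).1 e)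
    have hqr : m.idxOf q ≠ m.idxOf r := fun e => hj.2.2.2.2.2 ((List.idxOf_inj hq).1 e)
    by_contra hcon
    have hcases : (m.idxOf p < m.idxOf r ∧ m.idxOf r < m.idxOf q) ∨
        (m.idxOf r < m.idxOf p ∧ m.idxOf p < m.idxOf q) ∨
        (m.idxOf r < m.idxOf q ∧ m.idxOf q < m.idxOf p) := by
      simp only [Set.mem_union, Set.mem_ofPred_eq, hm, true_and] at hcon
      omega
    clear hcon hpq hpr hqr
    rcases hcases with ⟨hi1, hi2⟩ | ⟨hi1, hi2⟩ | ⟨hi1, hi2⟩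
    all_goals
      obtain ⟨s₀, s₁, s₂, s₃, rfl⟩ := exists_append_of_idxOf_lt_of_lt
        (nodup_of_mem_pathLists hm) (by assumption) hi1 hi2
      obtain ⟨S₀, S₁, S₂, S₃, -, -, -, -, -, hmem, g0, -, -, g3⟩ :=
        h.exists_segments hm (by simp) (by simp) (by simp)
      clear hi1 hi2 hm hp hq hr
      replace g0 : S₀ ⊆ A := by grind
      replace g3 : S₃ ⊆ B := by grind
      grind
  rw [hu, Set.encard_union_eq, Set.encard_union_eq, h.setOf_pathLists_qrp huB huC hvA hvC,
    h.setOf_pathLists_pqr huA huB hvA hvC, h.setOf_pathLists_qpr huA huC hvA hvC,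
    encard_joinAt_pathLists, encard_joinAt_pathLists, encard_joinAt_pathLists,
    encard_joinAt_pathLists]
  · congr 1
    split_ifs
    · exact encard_joinAt_pathLists
    · exact Set.encard_empty
  · rw [Set.disjoint_left]
    rintro m ⟨-, h1, h2⟩ ⟨-, h3, h4⟩
    omega
  · rw [Set.disjoint_left]
    rintro m hm ⟨-, h3, h4⟩
    rcases hm with ⟨-, h1, h2⟩ | ⟨-, h1, h2⟩ <;> omega

end IsGluing
theorem append_mem_cycleLists {s t : List α} (hs : s ∈ pathLists R S q w)
    (ht : t ∈ pathLists R T w q) (h : ∀ x ∈ S, x ∈ T → x = w ∨ x = q) :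
    s ++ w :: t ∈ cycleLists R (S ∪ T) q := by
  obtain ⟨hs1, hs2, hs3⟩ := hs
  obtain ⟨ht1, ht2, ht3⟩ := ht
  refine ⟨?_, ?_, ?_⟩
  · have e : q :: (s ++ w :: t) = (q :: s ++ [w]) ++ t := by simp
    rw [e, List.nodup_append]
    refine ⟨hs1, by grind, ?_⟩
    grind
  · have e : q :: (s ++ w :: t) ++ [q] = (q :: s) ++ w :: (t ++ [q]) := by simp
    rw [e, List.isChain_split]
    exact ⟨hs2, ht2⟩
  · grind

theorem exists_mem_pathLists_of_mem_cycleLists {s t : List α}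
    (h : s ++ w :: t ∈ cycleLists R S q) :
    ∃ S₁ S₂ : Set α, s ∈ pathLists R S₁ q w ∧ t ∈ pathLists R S₂ w q ∧ S₁ ∪ S₂ = S ∧
      ∀ x ∈ S₁, x ∈ S₂ → x = w ∨ x = q := by
  obtain ⟨h1, h2, h3⟩ := h
  have e : q :: (s ++ w :: t) ++ [q] = (q :: s) ++ w :: (t ++ [q]) := by simp
  rw [e, List.isChain_split] at h2
  refine ⟨{x | x ∈ q :: s ++ [w]}, {x | x ∈ w :: t ++ [q]}, ⟨?_, h2.1, fun _ => Iff.rfl⟩,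
    ⟨?_, h2.2, fun _ => Iff.rfl⟩, ?_, ?_⟩
  · exact h1.sublist (by simp)
  · grind
  · ext x
    rw [← h3]
    simp only [Set.mem_union, Set.mem_ofPred_eq, List.mem_append, List.mem_cons]
    tauto
  · intro x hx hx'
    simp only [Set.mem_ofPred_eq] at hx hx'
    grind

/-- The number of Hamiltonian closed walks does not depend on the base point. -/
theorem encard_cycleLists_congr (hu : u ∈ S) (hv : v ∈ S) :
    (cycleLists R S u).encard = (cycleLists R S v).encard := by
  suffices key : ∀ u ∈ S, ∀ v ∈ S, (cycleLists R S u).encard ≤ (cycleLists R S v).encard from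
    le_antisymm (key u hu v hv) (key v hv u hu)
  intro u hu v hv
  rcases eq_or_ne v u with rfl | hne
  · exact le_rfl
  have hsplit : ∀ m : List α, ∃ st : List α × List α, m ∈ cycleLists R S u →
      m = st.1 ++ v :: st.2 := by
    intro m
    by_cases hm : m ∈ cycleLists R S u
    · obtain ⟨s, t, rfl⟩ := List.append_of_mem (a := v) (l := m)
        (by simpa [hne] using (hm.2.2 v).2 hv)
      exact ⟨(s, t), fun _ => rfl⟩
    · exact ⟨([], []), fun h => absurd h hm⟩
  choose st hst using hsplit
  refine Set.encard_le_encard_of_injOn (f := fun m => (st m).2 ++ u :: (st m).1) ?_ ?_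
  · intro m hm
    obtain ⟨S₁, S₂, h1, h2, rfl, h3⟩ := exists_mem_pathLists_of_mem_cycleLists (hst m hm ▸ hm)
    rw [Set.union_comm]
    exact append_mem_cycleLists h2 h1 fun x hx hx' => (h3 x hx' hx).symm
  · intro m hm m' hm' heq
    have hn := hm.1
    have hn' := hm'.1
    rw [hst m hm] at hn ⊢
    rw [hst m' hm'] at hn' ⊢
    have := (List.append_cons_inj_of_notMem (by grind) (by grind)).1 heq
    rw [this.1, this.2.2]

namespace IsGluing

theorem setOf_cycleLists (h : IsGluing R A B C p q r) :
    {m ∈ cycleLists R (A ∪ B ∪ C) q | m.idxOf p < m.idxOf r} =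
      joinAt p (pathLists R A q p) (joinAt r (pathLists R B p r) (pathLists R C r q)) := by
  have hj := h.junctions
  have hAB := h.inter_AB
  have hAC := h.inter_AC
  have hBC := h.inter_BC
  ext m
  constructor
  · rintro ⟨hm, hi⟩
    have hr : r ∈ m := by
      have := (hm.2.2 r).2 (by grind)
      grind
    obtain ⟨s₀, s₁, s₂, rfl⟩ := exists_append_of_idxOf_lt hr hi
    obtain ⟨S₀, T₀, h0, hm₀, e0, d0⟩ := exists_mem_pathLists_of_mem_cycleLists hm
    obtain ⟨S₁, S₂, h1, h2, e1, d1⟩ := exists_mem_pathLists_of_append hm₀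
    clear hm hm₀ hi hr
    subst e1
    have m0 := ends_mem_of_mem_pathLists h0
    have m1 := ends_mem_of_mem_pathLists h1
    have m2 := ends_mem_of_mem_pathLists h2
    have g0 := h.subset_of_mem_pathLists h0 (by grind) (by grind) (by grind) (by grind)
    have g1 := h.subset_of_mem_pathLists h1 (by grind) (by grind) (by grind) (by grind)
    have g2 := h.subset_of_mem_pathLists h2 (by grind) (by grind) (by grind) (by grind)
    have hS : ∀ x, (x ∈ S₀ ∨ x ∈ S₁ ∨ x ∈ S₂) ↔ x ∈ A ∨ x ∈ B ∨ x ∈ C := fun x => by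
      have := congrArg (x ∈ ·) e0
      grind
    clear e0
    replace g0 : S₀ ⊆ A := by grind
    replace g1 : S₁ ⊆ B := by grind
    replace g2 : S₂ ⊆ C := by grind
    have e0 : S₀ = A := by ext x; grind
    have e1 : S₁ = B := by ext x; grind
    have e2 : S₂ = C := by ext x; grind
    exact ⟨s₀, e0 ▸ h0, _, ⟨s₁, e1 ▸ h1, s₂, e2 ▸ h2, rfl⟩, rfl⟩
  · rintro ⟨s, hs, -, ⟨s', hs', t, ht, rfl⟩, rfl⟩
    have hm := append_mem_cycleLists hs (append_mem_pathLists hs' ht (by grind)) (by grind)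
    rw [← Set.union_assoc] at hm
    exact ⟨hm, idxOf_lt_of_append hm.1.of_cons (by simp)⟩

theorem encard_cycleLists (h : IsGluing R A B C p q r) :
    (cycleLists R (A ∪ B ∪ C) q).encard =
      (pathLists R A q p).encard * ((pathLists R B p r).encard * (pathLists R C r q).encard) +
      (pathLists R C q r).encard * ((pathLists R B r p).encard * (pathLists R A p q).encard) := by
  have hj := h.junctions
  have hS : C ∪ B ∪ A = A ∪ B ∪ C := by
    ext x
    simp only [Set.mem_union]
    tauto
  have hu : cycleLists R (A ∪ B ∪ C) q =
      {m ∈ cycleLists R (A ∪ B ∪ C) q | m.idxOf p < m.idxOf r} ∪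
      {m ∈ cycleLists R (A ∪ B ∪ C) q | m.idxOf r < m.idxOf p} := by
    ext m
    refine ⟨fun hm => ?_, by grind⟩
    have hp : p ∈ m := by
      have := (hm.2.2 p).2 (by grind)
      grind
    have hpr : m.idxOf p ≠ m.idxOf r := fun e => hj.2.2.2.2.1 ((List.idxOf_inj hp).1 e)
    exact hpr.lt_or_gt.imp (fun hi => ⟨hm, hi⟩) fun hi => ⟨hm, hi⟩
  have hswap := h.swap.setOf_cycleLists
  rw [hS] at hswap
  rw [hu, Set.encard_union_eq, h.setOf_cycleLists, hswap]
  · simp only [encard_joinAt_pathLists]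
  · rw [Set.disjoint_left]
    rintro m ⟨-, h1⟩ ⟨-, h2⟩
    omega

end IsGluing

end Lists

/-- The outmost vertices of `SG n`, which are also the translation vectors of the three copies of
`SG n` inside `SG (n + 1)`. -/
def corner (n : ℕ) : Fin 3 → ℝ × ℝ := ![o, a n, b n]

/-- The vertex set of the copy of `SG n` inside `SG (n + 1)` translated by `corner n i`. -/
def copy (n : ℕ) (i : Fin 3) : Set (ℝ × ℝ) := (· + corner n i) '' V n

/-- Barycentric coordinates with respect to the outmost vertices of `SG n`, scaled to have
sum `2 ^ n`. -/
def bary (n : ℕ) (x : ℝ × ℝ) : Fin 3 → ℝ :=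
  ![2 ^ n - x.1 - x.2 / sq3, x.1 - x.2 / sq3, 2 * (x.2 / sq3)]

theorem sq3_ne_zero : sq3 ≠ 0 := by
  simp [sq3]

theorem bary_injective (n : ℕ) : (bary n).Injective := by
  intro x y h
  have h1 := congrFun h 1
  have h2 := congrFun h 2
  simp only [bary, Matrix.cons_val] at h1 h2
  have h3 : x.2 / sq3 = y.2 / sq3 := by linarith
  refine Prod.ext (by linarith) ?_
  simpa [div_left_inj' sq3_ne_zero] using h3

theorem bary_corner (n : ℕ) (i k : Fin 3) :
    bary n (corner n i) k = if k = i then 2 ^ n else 0 := by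
  fin_cases i <;> fin_cases k <;> simp [bary, corner, o, a, b, sq3_ne_zero] <;> ring

theorem bary_sub_corner (n : ℕ) (x : ℝ × ℝ) (i k : Fin 3) :
    bary n (x - corner n i) k = bary (n + 1) x k - if k = i then 2 ^ n else 0 := by
  fin_cases i <;> fin_cases k <;>
    simp [bary, corner, o, a, b, sq3_ne_zero, sub_div] <;> ring

theorem bary_sum (n : ℕ) (x : ℝ × ℝ) : ∑ k, bary n x k = 2 ^ n := by
  simp [bary, Fin.sum_univ_three]
  ring

theorem corner_injective (n : ℕ) : (corner n).Injective := by
  intro i j h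
  have := bary_corner n j i
  rw [← h, bary_corner] at this
  by_contra hij
  simp [hij] at this

theorem corner_succ (n : ℕ) (i : Fin 3) : corner (n + 1) i = corner n i + corner n i := by
  fin_cases i <;> ext <;> simp [corner, o, a, b] <;> ring

theorem mem_copy {n : ℕ} {i : Fin 3} {x : ℝ × ℝ} : x ∈ copy n i ↔ x - corner n i ∈ V n := by
  simp [copy, sub_eq_add_neg]

theorem mem_V_succ {n : ℕ} {x : ℝ × ℝ} : x ∈ V (n + 1) ↔ ∃ i, x ∈ copy n i := by
  have : o = 0 := rfl
  simp [V, copy, corner, Fin.exists_fin_succ, or_assoc, this]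

theorem V_zero : V 0 = Set.range (corner 0) := by
  ext x
  simp only [V, corner, Set.mem_range, Fin.exists_fin_succ, Set.mem_insert_iff,
    Set.mem_singleton_iff]
  simp [eq_comm]

theorem V_succ (n : ℕ) {i j k : Fin 3} (hij : i ≠ j) (hik : i ≠ k) (hjk : j ≠ k) :
    V (n + 1) = copy n i ∪ copy n j ∪ copy n k := by
  ext x
  rw [mem_V_succ, Set.mem_union, Set.mem_union]
  refine ⟨fun ⟨l, hl⟩ => ?_, ?_⟩
  · obtain rfl | rfl | rfl : l = i ∨ l = j ∨ l = k := by omega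
    · exact .inl (.inl hl)
    · exact .inl (.inr hl)
    · exact .inr hl
  · rintro ((h | h) | h) <;> exact ⟨_, h⟩

theorem corner_mem_V (n : ℕ) (i : Fin 3) : corner n i ∈ V n := by
  induction n with
  | zero => rw [V_zero]; exact ⟨i, rfl⟩
  | succ n ih => exact mem_V_succ.2 ⟨i, mem_copy.2 (by simpa [corner_succ] using ih)⟩

theorem corner_add_corner_mem_copy (n : ℕ) (i j : Fin 3) : corner n j + corner n i ∈ copy n i :=
  ⟨_, corner_mem_V n j, rfl⟩

theorem bary_nonneg {n : ℕ} {x : ℝ × ℝ} (hx : x ∈ V n) (k : Fin 3) : 0 ≤ bary n x k := by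
  induction n generalizing x with
  | zero =>
    rw [V_zero] at hx
    obtain ⟨i, rfl⟩ := hx
    rw [bary_corner]
    split_ifs <;> simp
  | succ n ih =>
    obtain ⟨i, hi⟩ := mem_V_succ.1 hx
    have := ih (mem_copy.1 hi)
    rw [bary_sub_corner] at this
    split_ifs at this
    · have : (0 : ℝ) < 2 ^ n := by positivity
      linarith
    · linarith

theorem le_bary_of_mem_copy {n : ℕ} {i : Fin 3} {x : ℝ × ℝ} (hx : x ∈ copy n i) :
    2 ^ n ≤ bary (n + 1) x i := by
  have := bary_nonneg (mem_copy.1 hx) i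
  rw [bary_sub_corner, if_pos rfl] at this
  linarith

theorem mem_copy_inter_iff {n : ℕ} {i j : Fin 3} (hij : i ≠ j) {x : ℝ × ℝ} :
    x ∈ copy n i ∧ x ∈ copy n j ↔ x = corner n i + corner n j := by
  constructor
  · rintro ⟨hi, hj⟩
    have h1 := le_bary_of_mem_copy hi
    have h2 := le_bary_of_mem_copy hj
    have h3 : ∀ k, 0 ≤ bary (n + 1) x k := bary_nonneg (mem_V_succ.2 ⟨i, hi⟩)
    have h4 := bary_sum (n + 1) x
    rw [Fin.sum_univ_three, pow_succ] at h4
    rw [← sub_eq_iff_eq_add']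
    apply bary_injective n
    ext k
    rw [bary_sub_corner, bary_corner]
    have := h3 0
    have := h3 1
    have := h3 2
    fin_cases i <;> fin_cases j <;> fin_cases k <;> simp at hij h1 h2 ⊢ <;> linarith
  · rintro rfl
    exact ⟨add_comm (corner n i) _ ▸ corner_add_corner_mem_copy n i j,
      corner_add_corner_mem_copy n j i⟩

theorem adj_zero {x y : ℝ × ℝ} : (G 0).Adj x y ↔ x ∈ V 0 ∧ y ∈ V 0 ∧ x ≠ y := by
  simp only [G, E, V, SimpleGraph.fromEdgeSet_adj, Set.mem_insert_iff, Set.mem_singleton_iff,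
    Sym2.eq_iff]
  grind

theorem adj_succ {n : ℕ} {x y : ℝ × ℝ} :
    (G (n + 1)).Adj x y ↔ ∃ i, (G n).Adj (x - corner n i) (y - corner n i) := by
  have key : ∀ v : ℝ × ℝ, s(x, y) ∈ Sym2.map (· + v) '' E n ↔ s(x - v, y - v) ∈ E n := by
    intro v
    constructor
    · rintro ⟨e, he, h⟩
      have := congrArg (Sym2.map (· - v)) h
      rw [Sym2.map_map] at this
      have hid : ((fun z : ℝ × ℝ => z - v) ∘ fun z => z + v) = id := by ext z <;> simp
      rw [hid, Sym2.map_id, id] at this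
      rw [this] at he
      simpa using he
    · exact fun h => ⟨_, h, by simp⟩
  have : o = 0 := rfl
  simp only [G, E, SimpleGraph.fromEdgeSet_adj, Set.mem_union, key, Fin.exists_fin_succ, corner]
  simp [this]
  tauto

theorem mem_V_of_adj {n : ℕ} {x y : ℝ × ℝ} (h : (G n).Adj x y) : x ∈ V n ∧ y ∈ V n := by
  induction n generalizing x y with
  | zero => exact ⟨(adj_zero.1 h).1, (adj_zero.1 h).2.1⟩
  | succ n ih =>
    obtain ⟨i, hi⟩ := adj_succ.1 h
    exact ⟨mem_V_succ.2 ⟨i, mem_copy.2 (ih hi).1⟩, mem_V_succ.2 ⟨i, mem_copy.2 (ih hi).2⟩⟩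

theorem adj_add_corner_iff {n : ℕ} {i : Fin 3} {x y : ℝ × ℝ} (hx : x ∈ V n) (hy : y ∈ V n) :
    (G (n + 1)).Adj (x + corner n i) (y + corner n i) ↔ (G n).Adj x y := by
  rw [adj_succ]
  constructor
  · rintro ⟨j, hj⟩
    rcases eq_or_ne i j with rfl | hij
    · simpa using hj
    · have hm := mem_V_of_adj hj
      have h1 := (mem_copy_inter_iff hij).1 ⟨⟨x, hx, rfl⟩, mem_copy.2 hm.1⟩
      have h2 := (mem_copy_inter_iff hij).1 ⟨⟨y, hy, rfl⟩, mem_copy.2 hm.2⟩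
      exact absurd (h1.trans h2.symm) (adj_succ.2 ⟨j, hj⟩).ne
  · exact fun h => ⟨i, by simpa using h⟩

theorem isGluing_copy (n : ℕ) {i j k : Fin 3} (hij : i ≠ j) (hik : i ≠ k) (hjk : j ≠ k) :
    IsGluing (G (n + 1)).Adj (copy n i) (copy n j) (copy n k) (corner n i + corner n j)
      (corner n i + corner n k) (corner n j + corner n k) where
  inter_AB _ := mem_copy_inter_iff hij
  inter_AC _ := mem_copy_inter_iff hik
  inter_BC _ := mem_copy_inter_iff hjk
  notMem h := by
    have := (mem_copy_inter_iff hik).1 ⟨((mem_copy_inter_iff hij).2 rfl).1, h⟩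
    exact hjk (corner_injective n (add_left_cancel this))
  edge x _ y _ hxy := by
    obtain ⟨l, hl⟩ := adj_succ.1 hxy
    have hx := mem_copy.2 (mem_V_of_adj hl).1
    have hy := mem_copy.2 (mem_V_of_adj hl).2
    obtain rfl | rfl | rfl : l = i ∨ l = j ∨ l = k := by omega
    all_goals tauto

theorem encard_pathLists_translate {n : ℕ} {i : Fin 3} {S : Set (ℝ × ℝ)} (hS : S ⊆ V n)
    (u v : ℝ × ℝ) :
    (pathLists (G (n + 1)).Adj ((· + corner n i) '' S) (u + corner n i) (v + corner n i)).encard =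
      (pathLists (G n).Adj S u v).encard :=
  encard_pathLists_image (add_left_injective _) fun _ hx _ hy => adj_add_corner_iff (hS hx) (hS hy)

/-- `HasPathCounts n k l`: between any two outmost vertices, `SG n` has `k` Hamiltonian paths, and
`SG n` without its third outmost vertex has `l` of them. -/
def HasPathCounts (n k l : ℕ) : Prop :=
  ∀ i j m : Fin 3, i ≠ j → i ≠ m → j ≠ m →
    (pathLists (G n).Adj (V n) (corner n i) (corner n j)).encard = k ∧
    (pathLists (G n).Adj (V n \ {corner n m}) (corner n i) (corner n j)).encard = l

theorem pathLists_pair {α : Type*} {R : α → α → Prop} {x y : α} (hxy : x ≠ y) (h : R x y) :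
    pathLists R {x, y} x y = {[]} := by
  ext m
  constructor
  · rintro ⟨h1, -, h3⟩
    refine List.eq_nil_iff_forall_not_mem.2 fun z hz => ?_
    have : z ∈ ({x, y} : Set α) := (h3 z).1 (by simp [hz])
    grind
  · rintro rfl
    exact ⟨by simpa using hxy, by simpa using h, by simp⟩

theorem pathLists_triple {α : Type*} {R : α → α → Prop} {x y z : α} (hxy : x ≠ y) (hxz : x ≠ z)
    (hyz : y ≠ z) (h : R x z) (h' : R z y) : pathLists R {x, y, z} x y = {[z]} := by
  ext m
  constructor
  · rintro ⟨h1, -, h3⟩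
    refine List.perm_singleton.1 ((List.perm_ext_iff_of_nodup ?_ (by simp)).2 fun w => ?_)
    · exact h1.sublist ((List.sublist_cons_self x m).trans (List.sublist_append_left _ _))
    · have := h3 w
      simp only [Set.mem_insert_iff, Set.mem_singleton_iff] at this
      grind
  · rintro rfl
    refine ⟨by simp [*, hyz.symm], by simp [h, h'], fun w => ?_⟩
    simp only [Set.mem_insert_iff, Set.mem_singleton_iff]
    grind

theorem hasPathCounts_zero : HasPathCounts 0 1 1 := by
  intro i j m hij him hjm
  have hV : V 0 = {corner 0 i, corner 0 j, corner 0 m} := by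
    rw [V_zero]
    ext x
    simp only [Set.mem_range, Set.mem_insert_iff, Set.mem_singleton_iff]
    constructor
    · rintro ⟨l, rfl⟩
      obtain rfl | rfl | rfl : l = i ∨ l = j ∨ l = m := by omega
      all_goals simp
    · rintro (rfl | rfl | rfl) <;> exact ⟨_, rfl⟩
  have hadj : ∀ i j, i ≠ j → (G 0).Adj (corner 0 i) (corner 0 j) := fun i j h =>
    adj_zero.2 ⟨corner_mem_V 0 i, corner_mem_V 0 j, (corner_injective 0).ne h⟩
  have hij' := (corner_injective 0).ne hij
  have him' := (corner_injective 0).ne him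
  have hjm' := (corner_injective 0).ne hjm
  have hV' : V 0 \ {corner 0 m} = {corner 0 i, corner 0 j} := by
    rw [hV]
    ext x
    simp only [Set.mem_sdiff, Set.mem_insert_iff, Set.mem_singleton_iff]
    grind
  rw [hV', pathLists_pair hij' (hadj _ _ hij), hV,
    pathLists_triple hij' him' hjm' (hadj _ _ him) (hadj _ _ hjm.symm)]
  simp

section PathCounts

variable {n k l : ℕ} {i j m : Fin 3}

theorem HasPathCounts.encard_copy (h : HasPathCounts n k l) (i : Fin 3) {j m : Fin 3}
    (hjm : j ≠ m) :
    (pathLists (G (n + 1)).Adj (copy n i) (corner n j + corner n i)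
      (corner n m + corner n i)).encard = k := by
  obtain ⟨t, hj, hm⟩ : ∃ t, j ≠ t ∧ m ≠ t := by decide +revert
  rw [copy, encard_pathLists_translate subset_rfl]
  exact (h j m t hjm hj hm).1

theorem HasPathCounts.encard_copy_diff (h : HasPathCounts n k l) (i : Fin 3) {j m t : Fin 3}
    (hjm : j ≠ m) (hjt : j ≠ t) (hmt : m ≠ t) :
    (pathLists (G (n + 1)).Adj (copy n i \ {corner n t + corner n i}) (corner n j + corner n i)
      (corner n m + corner n i)).encard = l := by
  have : copy n i \ {corner n t + corner n i} = (· + corner n i) '' (V n \ {corner n t}) := by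
    rw [Set.image_sdiff (add_left_injective _), Set.image_singleton, copy]
  rw [this, encard_pathLists_translate Set.sdiff_subset]
  exact (h j m t hjm hjt hmt).2

theorem corner_succ_notMem_copy (n : ℕ) (hij : i ≠ j) : corner (n + 1) i ∉ copy n j := by
  intro h
  have := le_bary_of_mem_copy h
  rw [bary_corner, if_neg hij.symm] at this
  have : (0 : ℝ) < 2 ^ n := by positivity
  linarith

theorem corner_succ_mem_copy (n : ℕ) (i : Fin 3) : corner (n + 1) i ∈ copy n i :=
  corner_succ n i ▸ corner_add_corner_mem_copy n i i

theorem copy_zero_subset (hij : i ≠ j) (him : i ≠ m) (hjm : j ≠ m) :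
    copy 0 m \ {corner 1 m} ⊆ {corner 0 i + corner 0 m, corner 0 j + corner 0 m} := by
  rintro x ⟨⟨y, hy, rfl⟩, hx⟩
  rw [V_zero] at hy
  obtain ⟨t, rfl⟩ := hy
  obtain rfl | rfl | rfl : t = i ∨ t = j ∨ t = m := by omega
  · simp
  · simp
  · exact absurd (corner_succ 0 _).symm hx

theorem not_copy_subset (n : ℕ) (hij : i ≠ j) :
    ¬ copy (n + 1) m \ {corner (n + 2) m} ⊆
      {corner (n + 1) i + corner (n + 1) m, corner (n + 1) j + corner (n + 1) m} := by
  have hmem : corner n i + corner n j ∈ V (n + 1) :=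
    mem_V_succ.2 ⟨i, ((mem_copy_inter_iff hij).2 rfl).1⟩
  have hne : ∀ t, corner n i + corner n j ≠ corner (n + 1) t := by
    intro t ht
    have h := (mem_copy_inter_iff (n := n) hij).2 rfl
    rw [ht] at h
    rcases eq_or_ne t i with rfl | hti
    · exact corner_succ_notMem_copy n hij h.2
    · exact corner_succ_notMem_copy n hti h.1
  intro h
  have := h ⟨⟨_, hmem, rfl⟩, fun h => hne m (by simpa [corner_succ (n + 1)] using h)⟩
  simp [hne] at this

theorem IsGluing.diff_singleton {α : Type*} {R : α → α → Prop} {A B C : Set α} {p q r w : α}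
    (h : IsGluing R A B C p q r) (hA : w ∉ A) (hB : w ∉ B) : IsGluing R A B (C \ {w}) p q r where
  inter_AB := h.inter_AB
  inter_AC x := by
    have := h.inter_AC x
    grind
  inter_BC x := by
    have := h.inter_BC x
    grind
  notMem hp := h.notMem hp.1
  edge x hx y hy hxy := by
    have := h.edge x (by grind) y (by grind) hxy
    grind

theorem HasPathCounts.succ (h : HasPathCounts n k l) :
    HasPathCounts (n + 1) (2 * k ^ 2 * l) (2 * k * l ^ 2 + if n = 0 then k ^ 2 else 0) := by
  intro i j m hij him hjm
  have hg := isGluing_copy n hij him hjm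
  have hi := corner_succ_mem_copy n i
  have hj := corner_succ_mem_copy n j
  have hm := corner_succ_mem_copy n m
  have hi' : ∀ t, i ≠ t → corner (n + 1) i ∉ copy n t := fun t => corner_succ_notMem_copy n
  have hj' : ∀ t, j ≠ t → corner (n + 1) j ∉ copy n t := fun t => corner_succ_notMem_copy n
  have hm' : ∀ t, m ≠ t → corner (n + 1) m ∉ copy n t := fun t => corner_succ_notMem_copy n
  have e : ∀ s t : Fin 3, corner n s + corner n t = corner n t + corner n s :=
    fun _ _ => add_comm _ _
  have h1 : (pathLists (G (n + 1)).Adj (copy n i \ {corner n i + corner n j}) (corner (n + 1) i)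
      (corner n i + corner n m)).encard = l := by
    simpa only [corner_succ, e] using h.encard_copy_diff i him hij hjm.symm
  have h2 := h.encard_copy m hij
  have h3 : (pathLists (G (n + 1)).Adj (copy n j) (corner n j + corner n m)
      (corner (n + 1) j)).encard = k := by
    simpa only [corner_succ, e] using h.encard_copy j hjm.symm
  have h4 : (pathLists (G (n + 1)).Adj (copy n i) (corner (n + 1) i)
      (corner n i + corner n m)).encard = k := by
    simpa only [corner_succ, e] using h.encard_copy i him
  have h5 : (pathLists (G (n + 1)).Adj (copy n j \ {corner n i + corner n j})
      (corner n j + corner n m) (corner (n + 1) j)).encard = l := by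
    simpa only [corner_succ, e] using h.encard_copy_diff j hjm.symm him.symm hij.symm
  have h6 := h.encard_copy_diff m hij him hjm
  rw [← corner_succ] at h6
  have h7 : (pathLists (G (n + 1)).Adj (copy n i) (corner (n + 1) i)
      (corner n i + corner n j)).encard = k := by
    simpa only [corner_succ, e] using h.encard_copy i hij
  have h8 : (pathLists (G (n + 1)).Adj (copy n j) (corner n i + corner n j)
      (corner (n + 1) j)).encard = k := by
    simpa only [corner_succ, e] using h.encard_copy j hij
  constructor
  · rw [V_succ n hij him hjm, hg.encard_pathLists hi (hi' j hij) (hi' m him) (hj' i hij.symm)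
      (hj' m hjm), h1, h2, h3, h4, h5, if_neg]
    · push_cast
      ring
    · intro hsub
      have hq := hm' i him.symm
      have hr := hm' j hjm.symm
      rcases hsub hm with h | h
      · exact hq (h ▸ hg.junctions.2.1.1)
      · exact hr (h ▸ hg.junctions.2.2.1.2.1)
  · have hV : V (n + 1) \ {corner (n + 1) m} =
        copy n i ∪ copy n j ∪ (copy n m \ {corner (n + 1) m}) := by
      have := hm' i him.symm
      have := hm' j hjm.symm
      rw [V_succ n hij him hjm]
      ext x
      grind
    have hg' := hg.diff_singleton (hm' i him.symm) (hm' j hjm.symm)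
    rw [hV, hg'.encard_pathLists hi (hi' j hij) (fun h => hi' m him h.1) (hj' i hij.symm)
      (fun h => hj' m hjm h.1), h1, h3, h4, h5, h6, h7, h8]
    cases n with
    | zero =>
      rw [if_pos (copy_zero_subset hij him hjm), if_pos rfl]
      push_cast
      ring
    | succ n =>
      rw [if_neg (not_copy_subset n hij), if_neg n.succ_ne_zero]
      push_cast
      ring

end PathCounts

/-- Every Hamiltonian cycle of `SG (n + 1)` consists of one Hamiltonian path in each copy
of `SG n`. -/
theorem HasPathCounts.encard_cycleLists {n k l : ℕ} (h : HasPathCounts n k l) :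
    (cycleLists (G (n + 1)).Adj (V (n + 1)) o).encard = 2 * k ^ 3 := by
  have h01 : (0 : Fin 3) ≠ 1 := by decide
  have h02 : (0 : Fin 3) ≠ 2 := by decide
  have h12 : (1 : Fin 3) ≠ 2 := by decide
  have hg := isGluing_copy n h01 h02 h12
  have hV := V_succ n h01 h02 h12
  have h1 := h.encard_copy 0 h12.symm
  have h2 := h.encard_copy 1 h02
  have h3 := h.encard_copy 2 h01.symm
  have h4 := h.encard_copy 2 h01
  have h5 := h.encard_copy 1 h02.symm
  have h6 := h.encard_copy 0 h12
  rw [show o = corner (n + 1) 0 from rfl, encard_cycleLists_congr (corner_mem_V (n + 1) 0)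
    (v := corner n 0 + corner n 2) (mem_V_succ.2 ⟨0, hg.junctions.2.1.1⟩), hV, hg.encard_cycleLists]
  simp only [add_comm (corner n 0), add_comm (corner n 1) (corner n 2)] at h1 h2 h3 h4 h5 h6 ⊢
  rw [h1, h2, h3, h4, h5, h6]
  ring

theorem exists_walk_support_eq {α : Type*} {Γ : SimpleGraph α} {m : List α} {u v : α}
    (h : (u :: m ++ [v]).IsChain Γ.Adj) : ∃ p : Γ.Walk u v, p.support = u :: m ++ [v] := by
  induction m generalizing u with
  | nil => exact ⟨.cons (by simpa using h) .nil, rfl⟩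
  | cons w m ih =>
    obtain ⟨hw, hm⟩ : Γ.Adj u w ∧ (w :: m ++ [v]).IsChain Γ.Adj := by simpa using h
    obtain ⟨p, hp⟩ := ih hm
    exact ⟨.cons hw p, by simp [hp]⟩

theorem isCycle_iff_of_support_eq {α : Type*} {Γ : SimpleGraph α} {m : List α} {u : α}
    {p : Γ.Walk u u} (h : p.support = u :: m ++ [u]) :
    p.IsCycle ↔ (u :: m).Nodup ∧ 2 ≤ m.length := by
  have hl := p.length_support
  have hn : ¬ p.Nil := fun hn => by
    rw [SimpleGraph.Walk.length_eq_zero_iff.2 hn] at hl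
    simp [h] at hl
  rw [SimpleGraph.Walk.isCycle_iff_isPath_tail_and_le_length, SimpleGraph.Walk.isPath_def,
    SimpleGraph.Walk.support_tail_of_not_nil _ hn, h]
  simp only [h, List.length_cons, List.length_append, List.length_nil, List.cons_append] at hl
  have hnd : (m ++ [u]).Nodup ↔ (u :: m).Nodup := (List.perm_append_singleton u m).nodup_iff
  rw [List.cons_append, List.tail_cons, hnd]
  refine and_congr_right fun _ => ?_
  omega

/-- A Hamiltonian cycle based at `o` corresponds to the list of its vertices other than `o`. -/
theorem card_isHamCycle (n : ℕ) :
    Nat.card {p : (G n).Walk o o // IsHamCycle n p} = (cycleLists (G n).Adj (V n) o).ncard := by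
  have hsupp : ∀ p : (G n).Walk o o, p.IsCycle → ∃ m, p.support = o :: m ++ [o] := by
    intro p hp
    cases p with
    | nil => exact absurd rfl hp.ne_nil
    | cons h q =>
      have := List.dropLast_append_getLast q.support_ne_nil
      rw [q.getLast_support] at this
      exact ⟨q.support.dropLast, by simp [this]⟩
  rw [← Nat.card_coe_set_eq]
  refine Nat.card_congr (Equiv.ofBijective (fun p => ⟨p.1.support.tail.dropLast, ?_⟩) ⟨?_, ?_⟩)
  · obtain ⟨p, hp, hV⟩ := p
    obtain ⟨m, hm⟩ := hsupp p hp
    have hc := p.isChain_adj_support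
    simp only [hm] at hV hc ⊢
    refine ⟨?_, ?_, ?_⟩
    · simpa using ((isCycle_iff_of_support_eq hm).1 hp).1
    · simpa using hc
    · intro x
      rw [← hV]
      simp
      tauto
  · rintro ⟨p, hp, hV⟩ ⟨p', hp', hV'⟩ heq
    obtain ⟨m, hm⟩ := hsupp p hp
    obtain ⟨m', hm'⟩ := hsupp p' hp'
    simp only [hm, hm', Subtype.mk.injEq] at heq
    have : m = m' := by simpa using heq
    exact Subtype.ext (SimpleGraph.Walk.ext_support (by rw [hm, hm', this]))
  · rintro ⟨m, h1, h2, h3⟩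
    obtain ⟨p, hp⟩ := exists_walk_support_eq h2
    have hlen : 2 ≤ m.length := by
      have hne : ∀ i, i ≠ 0 → corner n i ∈ m := fun i hi => by
        have ho : corner n i ≠ o := (corner_injective n).ne hi
        simpa [ho] using (h3 (corner n i)).2 (corner_mem_V n i)
      have hsub : [corner n 1, corner n 2] ⊆ m := by simp [hne]
      have hnd : [corner n 1, corner n 2].Nodup := by
        simpa using (corner_injective n).ne (by decide)
      exact (hnd.subperm hsub).length_le
    refine ⟨⟨p, (isCycle_iff_of_support_eq hp).2 ⟨h1, hlen⟩, fun x => ?_⟩, ?_⟩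
    · rw [← h3, hp]
      simp
      tauto
    · simp [hp]

theorem HasPathCounts.HC_succ {n k l : ℕ} (h : HasPathCounts n k l) : HC (n + 1) = k ^ 3 := by
  have : (cycleLists (G (n + 1)).Adj (V (n + 1)) o).ncard = 2 * k ^ 3 := by
    rw [Set.ncard, h.encard_cycleLists]
    exact_mod_cast ENat.toNat_natCast (2 * k ^ 3)
  rw [HC, card_isHamCycle, this]
  omega

theorem hasPathCounts_succ (n : ℕ) : ∃ t, 3 ^ n = 2 * t + 1 ∧
    HasPathCounts (n + 1) (2 ^ (2 * t + 1) * 3 ^ t) (2 ^ (2 * t) * 3 ^ (t + 1)) := by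
  induction n with
  | zero => exact ⟨0, rfl, by simpa using hasPathCounts_zero.succ⟩
  | succ n ih =>
    obtain ⟨t, ht, h⟩ := ih
    refine ⟨3 * t + 1, by rw [pow_succ, ht]; ring, ?_⟩
    convert h.succ using 1
    · ring
    · rw [if_neg n.succ_ne_zero]
      ring

/-- `HC 1 = 1` and for `n ≥ 2`,
`HC n = 2^(3^(n-1)) · 3^((3^(n-1)-3)/2)`. -/
theorem hamiltonian_cycles_closed_form :
    HC 1 = 1 ∧ ∀ n : ℕ, 2 ≤ n →
      HC n = 2 ^ 3 ^ (n - 1) * 3 ^ ((3 ^ (n - 1) - 3) / 2) := by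
  refine ⟨by simpa using hasPathCounts_zero.HC_succ, fun n hn => ?_⟩
  obtain ⟨n, rfl⟩ := Nat.exists_eq_add_of_le' hn
  obtain ⟨t, ht, h⟩ := hasPathCounts_succ n
  have e1 : 3 ^ (n + 2 - 1) = 3 * (2 * t + 1) := by
    rw [← ht, show n + 2 - 1 = n + 1 from rfl, pow_succ]
    ring
  rw [e1, h.HC_succ, show (3 * (2 * t + 1) - 3) / 2 = 3 * t by omega]
  ring

end SierpinskiGasket
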